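/- arXiv:2302.03669 — 5 statements merged into one kernel-verified Lean document; each statement's English description precedes it below -/
import Mathlib

section
/- (Lemma 1, first inequality.) Under the stability conditions G/U ≥ λ0 and R/U ≥ λn, and with p = max{1, λ0/(1 − λ0 − λn)}, one has (G + Y + O)²/U ≥ λ0·(p + 1)²·(Y + O)/p, and the inequality is strict whenever G ≠ p·(Y + O). -/
theorem add_one_sq_mul_mul_lt {p G S : ℝ} (hS : 0 < S) (hp : 1 ≤ p)
    (h : p = 1 ∨ p * S ≤ G) (hne : G ≠ p * S) :
    (p + 1) ^ 2 * S * G < p * (G + S) ^ 2 := by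
  rcases h with rfl | h
  · have : 0 < (G - S) ^ 2 := sq_pos_of_ne_zero (sub_ne_zero.mpr (by simpa using hne))
    linarith
  · have hlt : 0 < G - p * S := sub_pos.mpr (lt_of_le_of_ne h hne.symm)
    have hpos : 0 < p * G - S := by
      have hp0 : 0 < p := by linarith
      have hsq : 0 ≤ p ^ 2 - 1 := by nlinarith
      linarith [mul_pos hp0 hlt, mul_nonneg hsq hS.le]
    linarith [mul_pos hlt hpos]

theorem add_one_sq_mul_mul_le {p G S : ℝ} (hS : 0 < S) (hp : 1 ≤ p)
    (h : p = 1 ∨ p * S ≤ G) :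
    (p + 1) ^ 2 * S * G ≤ p * (G + S) ^ 2 := by
  by_cases hG : G = p * S
  · subst hG
    exact le_of_eq (by ring)
  · exact (add_one_sq_mul_mul_lt hS hp h hG).le

/-- Lemma 1, first inequality: Under the stability conditions `G/U ≥ λ0` and
`R/U ≥ λn`, and with `p = max{1, λ0/(1 − λ0 − λn)}`, one has
`(G + Y + O)²/U ≥ λ0·(p + 1)²·(Y + O)/p`, strictly whenever `G ≠ p·(Y + O)`. -/
theorem stmt_4 (l0 ln G R Y O U : ℝ)
    (hl0 : 0 < l0) (hl0' : l0 < 1) (hln : 0 < ln) (hln' : ln < 1)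
    (hG : 0 < G) (hR : 0 < R) (hY : 0 < Y) (hO : 0 < O)
    (hU : U = G + R + Y + O)
    (hstabG : l0 ≤ G / U) (hstabR : ln ≤ R / U) :
    let p := max 1 (l0 / (1 - l0 - ln))
    l0 * (p + 1) ^ 2 * (Y + O) / p ≤ (G + Y + O) ^ 2 / U ∧
    (G ≠ p * (Y + O) → l0 * (p + 1) ^ 2 * (Y + O) / p < (G + Y + O) ^ 2 / U) := by
  intro p
  have hU0 : 0 < U := by rw [hU]; positivity
  rw [le_div_iff₀ hU0] at hstabG hstabR
  have hS : 0 < Y + O := by positivity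
  have hd : 0 < 1 - l0 - ln := by
    have : 0 < (1 - l0 - ln) * U := by nlinarith
    exact pos_of_mul_pos_left this hU0.le
  have hp1 : 1 ≤ p := le_max_left _ _
  have hp0 : 0 < p := by linarith
  have hcritical : l0 / (1 - l0 - ln) * (Y + O) ≤ G := by
    rw [div_mul_eq_mul_div, div_le_iff₀ hd]
    have hSU : Y + O ≤ (1 - l0 - ln) * U := by nlinarith
    calc l0 * (Y + O) ≤ l0 * ((1 - l0 - ln) * U) := by gcongr
      _ = (l0 * U) * (1 - l0 - ln) := by ring
      _ ≤ G * (1 - l0 - ln) := by gcongr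
  have hcases : p = 1 ∨ p * (Y + O) ≤ G := by
    rcases max_choice 1 (l0 / (1 - l0 - ln)) with h | h
    · exact Or.inl h
    · exact Or.inr ((congrArg (· * (Y + O)) h).trans_le hcritical)
  have hstab : (G + Y + O) ^ 2 * l0 / G ≤ (G + Y + O) ^ 2 / U := by
    rw [div_le_div_iff₀ hG hU0]
    calc (G + Y + O) ^ 2 * l0 * U = (G + Y + O) ^ 2 * (l0 * U) := by ring
      _ ≤ (G + Y + O) ^ 2 * G := by gcongr
  constructor
  · refine le_trans ?_ hstab
    rw [div_le_div_iff₀ hp0 hG]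
    linarith [mul_le_mul_of_nonneg_left
      (add_one_sq_mul_mul_le hS hp1 hcases) hl0.le]
  · intro hne
    refine lt_of_lt_of_le ?_ hstab
    rw [div_lt_div_iff₀ hp0 hG]
    linarith [mul_lt_mul_of_pos_left
      (add_one_sq_mul_mul_lt hS hp1 hcases hne) hl0]
end

section
/- (Lemma 1, second inequality.) Under the stability conditions G/U ≥ λ0 and R/U ≥ λn, and with q = max{1, λn/(1 − λ0 − λn)}, one has (R + Y + O)²/U ≥ λn·(q + 1)²·(Y + O)/q, and the inequality is strict whenever R ≠ q·(Y + O). -/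
/-- The gap between `(R + s)²/U` and `ln·(q + 1)²·s/q` when `ln·U ≤ R`, bounded below in factored form. -/
theorem le_sq_div_sub {ln R s U q : ℝ} (hln : 0 < ln) (hU : 0 < U) (hq : 0 < q)
    (hR : 0 < R) (hUR : ln * U ≤ R) :
    ((R - q * s) * (q * R - s)) * ln / (q * R) ≤
      (R + s) ^ 2 / U - ln * (q + 1) ^ 2 * s / q := by
  have h : ln * (R + s) ^ 2 / R ≤ (R + s) ^ 2 / U := by
    rw [div_le_div_iff₀ hR hU]
    nlinarith [mul_le_mul_of_nonneg_left hUR (sq_nonneg (R + s))]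
  have e : ((R - q * s) * (q * R - s)) * ln / (q * R) =
      ln * (R + s) ^ 2 / R - ln * (q + 1) ^ 2 * s / q := by
    field_simp
    ring
  linarith

/-- Lemma 1, second inequality: Under the stability conditions `G/U ≥ λ0` and
`R/U ≥ λn`, and with `q = max{1, λn/(1 − λ0 − λn)}`, one has
`(R + Y + O)²/U ≥ λn·(q + 1)²·(Y + O)/q`, strictly whenever `R ≠ q·(Y + O)`. -/
theorem stmt_5 (l0 ln G R Y O U : ℝ)
    (hl0 : 0 < l0) (hl0' : l0 < 1) (hln : 0 < ln) (hln' : ln < 1)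
    (hG : 0 < G) (hR : 0 < R) (hY : 0 < Y) (hO : 0 < O)
    (hU : U = G + R + Y + O)
    (hstabG : l0 ≤ G / U) (hstabR : ln ≤ R / U) :
    let q := max 1 (ln / (1 - l0 - ln))
    ln * (q + 1) ^ 2 * (Y + O) / q ≤ (R + Y + O) ^ 2 / U ∧
    (R ≠ q * (Y + O) → ln * (q + 1) ^ 2 * (Y + O) / q < (R + Y + O) ^ 2 / U) := by
  intro q
  have hU0 : 0 < U := by linarith
  have hs : 0 < Y + O := by linarith
  rw [le_div_iff₀ hU0] at hstabG hstabR
  have hsd : Y + O ≤ (1 - l0 - ln) * U := by linarith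
  have hd : 0 < 1 - l0 - ln := pos_of_mul_pos_left (hs.trans_le hsd) hU0.le
  have hq1 : 1 ≤ q := le_max_left _ _
  have hq : 0 < q := by linarith
  have hratio : ln / (1 - l0 - ln) * (Y + O) ≤ R := by
    calc ln / (1 - l0 - ln) * (Y + O)
        ≤ ln / (1 - l0 - ln) * ((1 - l0 - ln) * U) := by gcongr
      _ = ln * U := by field_simp
      _ ≤ R := hstabR
  have hgap := le_sq_div_sub (s := Y + O) hln hU0 hq hR hstabR
  rw [← add_assoc] at hgap
  have hstrict : R ≠ q * (Y + O) → 0 < (R - q * (Y + O)) * (q * R - (Y + O)) := by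
    intro hne
    rcases max_choice 1 (ln / (1 - l0 - ln)) with h | h
    · have hq' : q = 1 := h
      rw [hq', one_mul] at hne ⊢
      rw [one_mul]
      exact mul_self_pos.mpr (sub_ne_zero.mpr hne)
    · have hq' : q = ln / (1 - l0 - ln) := h
      rw [← hq'] at hratio
      have hlt : q * (Y + O) < R := lt_of_le_of_ne hratio (Ne.symm hne)
      have h1 : Y + O ≤ q * (Y + O) := le_mul_of_one_le_left hs.le hq1
      have h2 : R ≤ q * R := le_mul_of_one_le_left hR.le hq1
      exact mul_pos (by linarith) (by linarith)
  have hlt : R ≠ q * (Y + O) →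
      ln * (q + 1) ^ 2 * (Y + O) / q < (R + Y + O) ^ 2 / U := by
    intro hne
    have : 0 < ((R - q * (Y + O)) * (q * R - (Y + O))) * ln / (q * R) :=
      div_pos (mul_pos (hstrict hne) hln) (mul_pos hq hR)
    linarith
  refine ⟨?_, hlt⟩
  by_cases heq : R = q * (Y + O)
  · rw [sub_eq_zero.mpr heq, zero_mul, zero_mul, zero_div] at hgap
    linarith
  · exact (hlt heq).le
end

section
/- Under the greenwave parameters, for every cross-street arrival rate λn with 0 < λn ≤ λmax, the per-cycle cross-street workload surplus satisfies R(δ) − λn·U(δ) = (Y + O)·[(1 + δ)·λmax − λn·(1 + δ(λ0 + λmax))] / (1 − λ0 − λmax), and this quantity is strictly positive whenever δ > 0. -/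
/-- Under the greenwave parameters, for every cross-street arrival rate `λn`
with `0 < λn ≤ λmax`, the per-cycle cross-street workload surplus satisfies
`R(δ) − λn·U(δ) = (Y + O)·[(1 + δ)·λmax − λn·(1 + δ(λ0 + λmax))] / (1 − λ0 − λmax)`,
strictly positive whenever `δ > 0`. -/
theorem stmt_13 (l0 lmax ln Y O δ : ℝ)
    (hl0 : 0 < l0) (hl0' : l0 < 1) (hlmax : 0 < lmax) (hlmax' : lmax < 1)
    (hsum : l0 + lmax < 1) (hY : 0 < Y) (hO : 0 < O) (hδ : 0 ≤ δ)
    (hln : 0 < ln) (hln' : ln ≤ lmax) :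
    let G := l0 * (1 + δ) * (Y + O) / (1 - l0 - lmax)
    let R := lmax * (1 + δ) * (Y + O) / (1 - l0 - lmax)
    let U := G + R + Y + O
    R - ln * U =
      (Y + O) * ((1 + δ) * lmax - ln * (1 + δ * (l0 + lmax))) / (1 - l0 - lmax) ∧
    (0 < δ → 0 < R - ln * U) := by
  intro G R U
  have hd : 0 < 1 - l0 - lmax := by linarith
  have surplus_eq : R - ln * U =
      (Y + O) * ((1 + δ) * lmax - ln * (1 + δ * (l0 + lmax))) / (1 - l0 - lmax) := by
    simp only [U, G, R]
    field_simp
    ring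
  refine ⟨surplus_eq, fun hδ_pos => ?_⟩
  rw [surplus_eq]
  have hs : 0 ≤ (lmax - ln) * (1 + δ * (l0 + lmax)) :=
    mul_nonneg (by linarith) (by positivity)
  have hp : 0 < δ * lmax * (1 - l0 - lmax) := by positivity
  have hb : 0 < (1 + δ) * lmax - ln * (1 + δ * (l0 + lmax)) := by linarith
  positivity
end

section
/- (Optimality of the greenwave policy, avenue queue, uniform cross traffic.) Let λ0, λ1 ∈ (0,1) with λ0 + λ1 < 1, 2λ0 + λ1 ≥ 1 and λ0 + 2λ1 ≥ 1. Then for all G, R, Y, O > 0 with U = G + R + Y + O satisfying the stability conditions G/U ≥ λ0 and R/U ≥ λ1, one has λ0·(R + Y + O)² / (2(1−λ0)·U) ≥ λ0·(1−λ0)·(Y + O) / (2(1 − λ0 − λ1)), with equality if and only if R = λ1·(Y + O)/(1 − λ0 − λ1) and U = (Y + O)/(1 − λ0 − λ1) (i.e., the greenwave parameters at δ = 0). In particular the greenwave policy minimizes the lower bound on the long-term average avenue queue length among all stable cycle parameters. -/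
/-- Optimality of the greenwave policy, avenue queue, uniform cross traffic:
Let `λ0, λ1 ∈ (0,1)` with `λ0 + λ1 < 1`, `2λ0 + λ1 ≥ 1` and `λ0 + 2λ1 ≥ 1`. Then for all
`G, R, Y, O > 0` with `U = G + R + Y + O` satisfying `G/U ≥ λ0` and `R/U ≥ λ1`, one has
`λ0·(R+Y+O)²/(2(1−λ0)·U) ≥ λ0·(1−λ0)·(Y+O)/(2(1−λ0−λ1))`, with equality if and only if
`R = λ1·(Y+O)/(1−λ0−λ1)` and `U = (Y+O)/(1−λ0−λ1)`. -/
theorem stmt_17 (l0 l1 : ℝ)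
    (hl0 : 0 < l0) (hl0' : l0 < 1) (hl1 : 0 < l1) (hl1' : l1 < 1)
    (hsum : l0 + l1 < 1) (hc1 : 1 ≤ 2 * l0 + l1) (hc2 : 1 ≤ l0 + 2 * l1) :
    ∀ G R Y O U : ℝ, 0 < G → 0 < R → 0 < Y → 0 < O →
      U = G + R + Y + O → l0 ≤ G / U → l1 ≤ R / U →
      (l0 * (1 - l0) * (Y + O) / (2 * (1 - l0 - l1)) ≤
          l0 * (R + Y + O) ^ 2 / (2 * (1 - l0) * U) ∧
        (l0 * (R + Y + O) ^ 2 / (2 * (1 - l0) * U) =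
            l0 * (1 - l0) * (Y + O) / (2 * (1 - l0 - l1)) ↔
          R = l1 * (Y + O) / (1 - l0 - l1) ∧ U = (Y + O) / (1 - l0 - l1))) := by
  intro G R Y O U hG hR hY hO hU h0 h1
  have hUpos : 0 < U := by rw [hU]; positivity
  have hd : 0 < 1 - l0 - l1 := by linarith
  have ha : 0 < 1 - l0 := by linarith
  have hT : 0 < Y + O := by positivity
  rw [le_div_iff₀ hUpos] at h0 h1
  have hkey : 0 ≤ (1 - l0 - l1) * (R + Y + O) - (1 - l0) * (Y + O) := by
    nlinarith [mul_nonneg ha.le (sub_nonneg.2 h1), mul_nonneg hl1.le (sub_nonneg.2 h0)]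
  have hle : 0 ≤ (l1 - (1 - l0 - l1)) * (R + Y + O) := mul_nonneg (by linarith) (by positivity)
  have hid : l1 * ((1 - l0 - l1) * (R + Y + O) ^ 2 - (1 - l0) ^ 2 * (Y + O) * U) =
      ((1 - l0 - l1) * (R + Y + O) - (1 - l0) * (Y + O)) *
        (l1 * (R + Y + O) - (1 - l0) * (Y + O)) +
      (1 - l0) ^ 2 * (Y + O) * (R - l1 * U) := by ring
  have hP : 0 ≤ ((1 - l0 - l1) * (R + Y + O) - (1 - l0) * (Y + O)) *
      (l1 * (R + Y + O) - (1 - l0) * (Y + O)) := mul_nonneg hkey (by linarith)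
  have hQ : 0 ≤ (1 - l0) ^ 2 * (Y + O) * (R - l1 * U) :=
    mul_nonneg (by positivity) (sub_nonneg.2 h1)
  have hdiff : l0 * (R + Y + O) ^ 2 / (2 * (1 - l0) * U) -
      l0 * (1 - l0) * (Y + O) / (2 * (1 - l0 - l1)) =
      l0 / (2 * (1 - l0) * U * (1 - l0 - l1)) *
        ((1 - l0 - l1) * (R + Y + O) ^ 2 - (1 - l0) ^ 2 * (Y + O) * U) := by
    field_simp
  have hc : 0 < l0 / (2 * (1 - l0) * U * (1 - l0 - l1)) := by positivity
  refine ⟨?_, ?_⟩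
  · rw [← sub_nonneg, hdiff]
    exact mul_nonneg hc.le (nonneg_of_mul_nonneg_right (by linarith) hl1)
  rw [← sub_eq_zero, hdiff, mul_eq_zero_iff_left hc.ne', eq_div_iff hd.ne', eq_div_iff hd.ne']
  constructor
  · intro h
    rw [h, mul_zero] at hid
    have hR' : R - l1 * U = 0 :=
      (mul_eq_zero.1 (by linarith : (1 - l0) ^ 2 * (Y + O) * (R - l1 * U) = 0)).resolve_left
        (by positivity)
    have hx : (1 - l0 - l1) * (R + Y + O) - (1 - l0) * (Y + O) = 0 := by
      rcases mul_eq_zero.1 (by linarith :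
        ((1 - l0 - l1) * (R + Y + O) - (1 - l0) * (Y + O)) *
          (l1 * (R + Y + O) - (1 - l0) * (Y + O)) = 0) with h' | h' <;> linarith
    have hRd : R * (1 - l0 - l1) = l1 * (Y + O) := by linarith
    exact ⟨hRd, mul_left_cancel₀ hl1.ne' (by linear_combination hRd - (1 - l0 - l1) * hR')⟩
  · rintro ⟨hRd, hUd⟩
    have hx : (1 - l0 - l1) * (R + Y + O) = (1 - l0) * (Y + O) := by linear_combination hRd
    refine (mul_eq_zero_iff_left hd.ne').1 ?_
    linear_combination ((1 - l0 - l1) * (R + Y + O) + (1 - l0) * (Y + O)) * hx -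
      (1 - l0) ^ 2 * (Y + O) * hUd
end

section
/- (Optimality of the greenwave policy, cross-street queue, uniform cross traffic.) Let λ0, λ1 ∈ (0,1) with λ0 + λ1 < 1, 2λ0 + λ1 ≥ 1 and λ0 + 2λ1 ≥ 1. Then for all G, R, Y, O > 0 with U = G + R + Y + O satisfying the stability conditions G/U ≥ λ0 and R/U ≥ λ1, one has λ1·(G + Y + O)² / (2(1−λ1)·U) ≥ λ1·(1−λ1)·(Y + O) / (2(1 − λ0 − λ1)), with equality if and only if G = λ0·(Y + O)/(1 − λ0 − λ1) and U = (Y + O)/(1 − λ0 − λ1) (i.e., the greenwave parameters at δ = 0). -/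
/-- Optimality of the greenwave policy, cross-street queue, uniform cross
traffic: Let `λ0, λ1 ∈ (0,1)` with `λ0 + λ1 < 1`, `2λ0 + λ1 ≥ 1` and `λ0 + 2λ1 ≥ 1`. Then
for all `G, R, Y, O > 0` with `U = G + R + Y + O` satisfying `G/U ≥ λ0` and `R/U ≥ λ1`, one
has `λ1·(G+Y+O)²/(2(1−λ1)·U) ≥ λ1·(1−λ1)·(Y+O)/(2(1−λ0−λ1))`, with equality if and only if
`G = λ0·(Y+O)/(1−λ0−λ1)` and `U = (Y+O)/(1−λ0−λ1)`. -/
theorem stmt_18 (l0 l1 : ℝ)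
    (hl0 : 0 < l0) (hl0' : l0 < 1) (hl1 : 0 < l1) (hl1' : l1 < 1)
    (hsum : l0 + l1 < 1) (hc1 : 1 ≤ 2 * l0 + l1) (hc2 : 1 ≤ l0 + 2 * l1) :
    ∀ G R Y O U : ℝ, 0 < G → 0 < R → 0 < Y → 0 < O →
      U = G + R + Y + O → l0 ≤ G / U → l1 ≤ R / U →
      (l1 * (1 - l1) * (Y + O) / (2 * (1 - l0 - l1)) ≤
          l1 * (G + Y + O) ^ 2 / (2 * (1 - l1) * U) ∧
        (l1 * (G + Y + O) ^ 2 / (2 * (1 - l1) * U) =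
            l1 * (1 - l1) * (Y + O) / (2 * (1 - l0 - l1)) ↔
          G = l0 * (Y + O) / (1 - l0 - l1) ∧ U = (Y + O) / (1 - l0 - l1))) := by
  intro G R Y O U hG hR hY hO hU hGU hRU
  have hUpos : 0 < U := by rw [hU]; positivity
  rw [le_div_iff₀ hUpos] at hGU hRU
  have hk : 0 < 1 - l0 - l1 := by linarith
  have hm : 0 < 1 - l1 := by linarith
  have hS : 0 < Y + O := by positivity
  have hkG : 0 ≤ (1 - l0 - l1) * G - l0 * (Y + O) := by
    have h1 : G + (Y + O) ≤ (1 - l1) * U := by linarith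
    have h2 := mul_le_mul_of_nonneg_left h1 hl0.le
    have h3 := mul_le_mul_of_nonneg_left hGU hm.le
    linarith
  have hle : 1 - l0 - l1 ≤ l0 := by linarith
  have hGS : Y + O ≤ G := by
    by_contra! h
    nlinarith
  have hlG : 0 ≤ l0 * G - (1 - l0 - l1) * (Y + O) := by nlinarith
  have hfirst := mul_nonneg hkG hlG
  have hsecond : 0 ≤ (1 - l1) ^ 2 * (Y + O) * (G - l0 * U) :=
    mul_nonneg (by positivity) (by linarith)
  have key : l0 * ((1 - l0 - l1) * (G + Y + O) ^ 2 - (1 - l1) ^ 2 * (Y + O) * U) =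
      ((1 - l0 - l1) * G - l0 * (Y + O)) * (l0 * G - (1 - l0 - l1) * (Y + O)) +
        (1 - l1) ^ 2 * (Y + O) * (G - l0 * U) := by ring
  refine ⟨?_, ?_, ?_⟩
  · have hE := nonneg_of_mul_nonneg_right (key ▸ add_nonneg hfirst hsecond) hl0
    rw [div_le_div_iff₀ (by positivity) (by positivity)]
    have := mul_nonneg hl1.le hE
    linarith
  · intro h
    rw [div_eq_div_iff (by positivity) (by positivity)] at h
    have hE : (1 - l0 - l1) * (G + Y + O) ^ 2 - (1 - l1) ^ 2 * (Y + O) * U = 0 := by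
      refine (mul_eq_zero.mp (?_ : (2 * l1) * _ = 0)).resolve_left (by positivity)
      linear_combination h
    rw [hE, mul_zero] at key
    have hU0 : G - l0 * U = 0 :=
      (mul_eq_zero.mp (by linarith : (1 - l1) ^ 2 * (Y + O) * (G - l0 * U) = 0)).resolve_left
        (by positivity)
    have hG0 : (1 - l0 - l1) * G = l0 * (Y + O) := by
      rcases mul_eq_zero.mp (by linarith : ((1 - l0 - l1) * G - l0 * (Y + O)) *
        (l0 * G - (1 - l0 - l1) * (Y + O)) = 0) with h | h
      · linarith
      · have h1 := mul_le_mul_of_nonneg_left hGS hl0.le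
        have h2 := mul_le_mul_of_nonneg_right hle hG.le
        have h3 := mul_le_mul_of_nonneg_right hle hS.le
        linarith
    refine ⟨by rw [eq_div_iff hk.ne']; linarith, ?_⟩
    rw [eq_div_iff hk.ne']
    apply mul_left_cancel₀ hl0.ne'
    linear_combination hG0 - (1 - l0 - l1) * hU0
  · rintro ⟨hG', hU'⟩
    have hsumG : G + Y + O = (1 - l1) * (Y + O) / (1 - l0 - l1) := by
      rw [add_assoc, hG']
      field_simp
      ring
    rw [hsumG, hU']
    field_simp
end
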